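/- For every real number k with 0 < k < 1 and k ≠ (√3 − 1)/2, the series ∑_{n=0}^∞ ((1/3)_n (2/3)_n / (n!)²) · P_n((1 − 4k + 6k² − 4k³ + 10k⁴)/((1 − 2k − 2k²)(1 − 2k + 4k²))) · ((1 + k + k²)(1 − 2k − 2k²)(1 − 2k + 4k²)/(1 + 2k)³)^n · (C₃n³ + C₂n² + C₁n + C₀) converges to √3·(1 + 2k)⁴(1 − 2k + 4k²)/π, where C₃ = (9(k−1)²k²/(1 + k + k²))(3 + 4k + 2k²)²(3 + 2k + 4k²)², C₂ = 27(k−1)k(9 − 18k + 10k² + 12k³ + 60k⁴ + 160k⁵ + 240k⁶ + 192k⁷ + 64k⁸), C₁ = 9 − 144k + 540k² − 584k³ + 314k⁴ − 228k⁵ − 1256k⁶ − 1072k⁷ + 768k⁸ + 2560k⁹ + 1280k¹⁰, and C₀ = 2(1 − 2k − 2k²)²(1 − 10k + 12k² − 24k³ + 16k⁴ + 32k⁶). -/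

import Mathlib

open Real Filter

/-- The Legendre polynomial of degree `n`, given by the explicit formula
`P_n(x) = 2^{-n} ∑_{j=0}^{n} C(n,j)^2 (x-1)^{n-j} (x+1)^j`. -/
noncomputable def legendreP (n : ℕ) (x : ℝ) : ℝ :=
  (2 : ℝ)⁻¹ ^ n *
    ∑ j ∈ Finset.range (n + 1), (n.choose j : ℝ) ^ 2 * (x - 1) ^ (n - j) * (x + 1) ^ j

/-- The Pochhammer symbol (rising factorial) `(a)_n = a (a+1) ⋯ (a+n-1)`. -/
noncomputable def poch (a : ℝ) (n : ℕ) : ℝ := (ascPochhammer ℝ n).eval a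

/-! ### Power series on an interval -/

/-- The sum of the real power series with coefficients `c`. -/
noncomputable def powerSum (c : ℕ → ℝ) (x : ℝ) : ℝ := ∑' n, c n * x ^ n

/-- The power series with coefficients `c` converges absolutely at every `s` with `|s| < r`. -/
def ConvergesBelow (c : ℕ → ℝ) (r : ℝ) : Prop :=
  ∀ s, 0 ≤ s → s < r → Summable fun n => |c n| * s ^ n

namespace ConvergesBelow

variable {c : ℕ → ℝ} {r x : ℝ}

theorem summable (h : ConvergesBelow c r) (hx : |x| < r) : Summable fun n => c n * x ^ n := by
  refine Summable.of_norm ?_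
  simpa [abs_mul, abs_pow] using h |x| (abs_nonneg x) hx

theorem natCast_mul (h : ConvergesBelow c r) : ConvergesBelow (fun n => n * c n) r := by
  intro s hs hsr
  obtain ⟨s', hs', hs'r⟩ := exists_between hsr
  have hs'0 : 0 < s' := hs.trans_lt hs'
  have hq : s / s' < 1 := (div_lt_one hs'0).2 hs'
  have hq0 : 0 ≤ s / s' := by positivity
  obtain ⟨C, hC⟩ := (tendsto_self_mul_const_pow_of_lt_one hq0 hq).bddAbove_range
  have hC' : ∀ n : ℕ, (n : ℝ) * (s / s') ^ n ≤ C := fun n => hC ⟨n, rfl⟩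
  refine Summable.of_nonneg_of_le (fun n => by positivity) (fun n => ?_)
    ((h s' hs'0.le hs'r).mul_left C)
  have e : |(n : ℝ) * c n| * s ^ n = (n * (s / s') ^ n) * (|c n| * s' ^ n) := by
    rw [abs_mul, Nat.abs_cast, div_pow]
    field_simp
  rw [e]
  exact mul_le_mul_of_nonneg_right (hC' n) (by positivity)

theorem hasDerivAt_aux (h : ConvergesBelow c r) (hx : |x| < r) :
    HasDerivAt (powerSum c) (∑' n : ℕ, c n * (n * x ^ (n - 1))) x := by
  obtain ⟨s, hxs, hsr⟩ := exists_between hx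
  have hs : 0 < s := (abs_nonneg x).trans_lt hxs
  have hu : Summable fun n : ℕ => |(n : ℝ) * c n| * s ^ n / s :=
    (h.natCast_mul s hs.le hsr).div_const s
  refine hasDerivAt_tsum_of_isPreconnected (t := Metric.ball 0 s) (y₀ := 0) hu Metric.isOpen_ball
    (convex_ball _ _).isPreconnected (fun n y _ => (hasDerivAt_pow n y).const_mul (c n)) ?_
    (Metric.mem_ball_self hs) ?_ (by simpa using hxs)
  · intro n y hy
    have hy' : |y| < s := by simpa using hy
    rcases n with _ | n
    · simp
    · rw [pow_succ s n, ← mul_assoc |_|, mul_div_cancel_right₀ _ hs.ne']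
      simp only [norm_mul, Real.norm_eq_abs, abs_mul, norm_pow, Nat.add_sub_cancel]
      have := pow_le_pow_left₀ (abs_nonneg y) hy'.le n
      calc |c (n + 1)| * (|((n + 1 : ℕ) : ℝ)| * |y| ^ n)
          = |((n + 1 : ℕ) : ℝ)| * |c (n + 1)| * |y| ^ n := by ring
        _ ≤ _ := by gcongr
  · exact h.summable (by simpa using hs.trans hsr)

theorem continuousAt (h : ConvergesBelow c r) (hx : |x| < r) : ContinuousAt (powerSum c) x :=
  (h.hasDerivAt_aux hx).continuousAt

theorem hasDerivAt (h : ConvergesBelow c r) (hx0 : x ≠ 0) (hx : |x| < r) :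
    HasDerivAt (powerSum c) (powerSum (fun n => n * c n) x / x) x := by
  convert h.hasDerivAt_aux hx using 1
  rw [powerSum, ← tsum_div_const]
  refine tsum_congr fun n => ?_
  rcases n with _ | n
  · simp
  · rw [pow_succ, Nat.add_sub_cancel]
    field_simp

theorem hasSum (h : ConvergesBelow c r) (hx : |x| < r) :
    HasSum (fun n => c n * x ^ n) (powerSum c x) :=
  (h.summable hx).hasSum

end ConvergesBelow

theorem powerSum_zero (c : ℕ → ℝ) : powerSum c 0 = c 0 := by
  rw [powerSum, tsum_eq_single 0 (fun n hn => by simp [hn])]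
  simp

/-! ### The cubic hypergeometric function -/

/-- The Taylor coefficients of `₂F₁(1/3, 2/3; 1; x)`. -/
noncomputable def cubicCoeff (n : ℕ) : ℝ := poch (1 / 3) n * poch (2 / 3) n / (n.factorial : ℝ) ^ 2

theorem cubicCoeff_zero : cubicCoeff 0 = 1 := by simp [cubicCoeff, poch]

theorem cubicCoeff_succ (n : ℕ) :
    cubicCoeff (n + 1) * (n + 1) ^ 2 = cubicCoeff n * (n ^ 2 + n + 2 / 9) := by
  have h : (n.factorial : ℝ) ≠ 0 := by positivity
  simp only [cubicCoeff, poch, ascPochhammer_succ_eval, Nat.factorial_succ]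
  push_cast
  field_simp
  ring

theorem cubicCoeff_pos (n : ℕ) : 0 < cubicCoeff n := by
  induction n with
  | zero => simp [cubicCoeff_zero]
  | succ n ih =>
    have h := cubicCoeff_succ n
    have h2 : 0 < cubicCoeff (n + 1) * (n + 1) ^ 2 := by rw [h]; positivity
    exact pos_of_mul_pos_left h2 (by positivity)

theorem cubicCoeff_le_one (n : ℕ) : cubicCoeff n ≤ 1 := by
  induction n with
  | zero => simp [cubicCoeff_zero]
  | succ n ih =>
    have h := cubicCoeff_succ n
    have hn : (0 : ℝ) ≤ n := n.cast_nonneg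
    have h2 : cubicCoeff (n + 1) * (n + 1) ^ 2 ≤ 1 * ((n : ℝ) + 1) ^ 2 := by
      rw [h]
      exact mul_le_mul ih (by nlinarith) (by positivity) zero_le_one
    exact le_of_mul_le_mul_right h2 (by positivity)

theorem convergesBelow_cubicCoeff : ConvergesBelow cubicCoeff 1 := by
  intro s hs hs1
  refine Summable.of_nonneg_of_le (fun n => by positivity) (fun n => ?_)
    (summable_geometric_of_lt_one hs hs1)
  rw [abs_of_pos (cubicCoeff_pos n)]
  exact mul_le_of_le_one_left (by positivity) (cubicCoeff_le_one n)

/-- The function `₂F₁(1/3, 2/3; 1; x)`. -/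
noncomputable def cubicF : ℝ → ℝ := powerSum cubicCoeff

/-- The quasi-derivative `x (1 - x) F'(x)` of `F = ₂F₁(1/3, 2/3; 1; ·)`. -/
noncomputable def cubicG (x : ℝ) : ℝ := (1 - x) * powerSum (fun n => n * cubicCoeff n) x

theorem cubicF_zero : cubicF 0 = 1 := by rw [cubicF, powerSum_zero, cubicCoeff_zero]

theorem cubicG_zero : cubicG 0 = 0 := by simp [cubicG, powerSum_zero]

theorem continuousAt_cubicF {x : ℝ} (hx : |x| < 1) : ContinuousAt cubicF x :=
  convergesBelow_cubicCoeff.continuousAt hx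

theorem continuousAt_cubicG {x : ℝ} (hx : |x| < 1) : ContinuousAt cubicG x :=
  (continuousAt_const.sub continuousAt_id).mul
    (convergesBelow_cubicCoeff.natCast_mul.continuousAt hx)

theorem hasDerivAt_cubicF {x : ℝ} (hx0 : 0 < x) (hx1 : x < 1) :
    HasDerivAt cubicF (cubicG x / (x * (1 - x))) x := by
  have h := convergesBelow_cubicCoeff.hasDerivAt hx0.ne' (by rwa [abs_of_pos hx0])
  have e : cubicG x / (x * (1 - x)) = powerSum (fun n => n * cubicCoeff n) x / x := by
    have : 1 - x ≠ 0 := by linarith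
    simp only [cubicG]
    field_simp
  rw [e]
  exact h

theorem hasDerivAt_cubicG {x : ℝ} (hx0 : 0 < x) (hx1 : x < 1) :
    HasDerivAt cubicG (2 / 9 * cubicF x) x := by
  have hx : |x| < 1 := by rwa [abs_of_pos hx0]
  have h0 := convergesBelow_cubicCoeff
  have h1 := h0.natCast_mul
  have h2 := h1.natCast_mul
  have key : powerSum (fun n => n * (n * cubicCoeff n)) x =
      x * (powerSum (fun n => n * (n * cubicCoeff n)) x + powerSum (fun n => n * cubicCoeff n) x +
        2 / 9 * cubicF x) := by
    have hs := (((h2.hasSum hx).add (h1.hasSum hx)).add ((h0.hasSum hx).mul_left (2 / 9))).mul_left x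
    rw [cubicF, ← hs.tsum_eq, powerSum, (h2.summable hx).tsum_eq_zero_add]
    simp only [CharP.cast_eq_zero, zero_mul, zero_add]
    refine tsum_congr fun n => ?_
    have := cubicCoeff_succ n
    push_cast
    rw [pow_succ]
    linear_combination x ^ n * x * this
  have hd := ((hasDerivAt_id' x).const_sub 1).mul (h1.hasDerivAt hx0.ne' hx)
  refine hd.congr_deriv ?_
  generalize powerSum (fun n => n * (n * cubicCoeff n)) x = E at key ⊢
  field_simp
  linear_combination 9 * key

theorem one_le_cubicF {x : ℝ} (hx0 : 0 ≤ x) (hx1 : x < 1) : 1 ≤ cubicF x := by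
  have h := (convergesBelow_cubicCoeff.summable (x := x) (by rwa [abs_of_nonneg hx0])).le_tsum 0
    (fun n _ => mul_nonneg (cubicCoeff_pos n).le (by positivity))
  simpa [cubicCoeff_zero, cubicF, powerSum] using h

theorem cubicF_mono {x y : ℝ} (hx0 : 0 ≤ x) (hxy : x ≤ y) (hy1 : y < 1) : cubicF x ≤ cubicF y := by
  refine Summable.tsum_le_tsum (fun n => ?_)
    (convergesBelow_cubicCoeff.summable (by rw [abs_of_nonneg hx0]; linarith))
    (convergesBelow_cubicCoeff.summable (by rwa [abs_of_nonneg (hx0.trans hxy)]))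
  have := (cubicCoeff_pos n).le
  gcongr

/-! ### Behaviour at the singular point `1` -/

theorem natCast_mul_cubicCoeff (n : ℕ) :
    ((n : ℝ) + 1) * cubicCoeff (n + 1) = 1 / π * (π * (1 / 3) *
      ∏ j ∈ Finset.range n, (1 - (1 / 3 : ℝ) ^ 2 / ((j : ℝ) + 1) ^ 2)) * ((n + 2 / 3) / (n + 1)) := by
  induction n with
  | zero =>
    have := cubicCoeff_succ 0
    simp [cubicCoeff_zero] at this
    simp [this]
    field_simp
    norm_num
  | succ n ih =>
    have := cubicCoeff_succ (n + 1)
    rw [Finset.prod_range_succ]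
    have e : cubicCoeff (n + 1 + 1) = (((n : ℝ) + 1) * cubicCoeff (n + 1)) *
        ((n + 1) ^ 2 + (n + 1) + 2 / 9) / ((n + 1) * (n + 2) ^ 2) := by
      push_cast at this
      field_simp
      linear_combination (9 : ℝ) * this
    rw [e, ih]
    push_cast
    field_simp
    ring

theorem tendsto_natCast_mul_cubicCoeff :
    Tendsto (fun n : ℕ => (n : ℝ) * cubicCoeff n) atTop (nhds (√3 / (2 * π))) := by
  rw [← tendsto_add_atTop_iff_nat 1]
  have h1 := (Real.tendsto_euler_sin_prod (1 / 3)).const_mul (1 / π)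
  have h2 : Tendsto (fun n : ℕ => ((n : ℝ) + 2 / 3) / (n + 1)) atTop (nhds 1) := by
    have h3 : Tendsto (fun n : ℕ => 1 - 1 / 3 * (1 / ((n : ℝ) + 1))) atTop (nhds (1 - 1 / 3 * 0)) :=
      tendsto_const_nhds.sub (tendsto_one_div_add_atTop_nhds_zero_nat.const_mul _)
    rw [mul_zero, sub_zero] at h3
    refine h3.congr fun n => ?_
    field_simp
    ring
  have h := h1.mul h2
  have e : π * (1 / 3) = π / 3 := by ring
  rw [e, Real.sin_pi_div_three] at h
  convert h using 1
  · funext n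
    push_cast
    rw [natCast_mul_cubicCoeff, e]
  · congr 1
    field_simp

theorem tendsto_cubicCoeff : Tendsto cubicCoeff atTop (nhds 0) := by
  have h := tendsto_natCast_mul_cubicCoeff.mul tendsto_one_div_atTop_nhds_zero_nat
  rw [mul_zero] at h
  refine h.congr' ?_
  filter_upwards [eventually_gt_atTop 0] with n hn
  have : (n : ℝ) ≠ 0 := by positivity
  field_simp

/-- Abel's theorem for `(1 - x) ∑ cₙ xⁿ` in terms of the limit of the coefficients. -/
theorem tendsto_one_sub_mul_powerSum {c : ℕ → ℝ} {l : ℝ} (hc : ConvergesBelow c 1)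
    (h : Tendsto c atTop (nhds l)) :
    Tendsto (fun x => (1 - x) * powerSum c x) (nhdsWithin 1 (Set.Iio 1)) (nhds l) := by
  let d : ℕ → ℝ := fun n => c n - if n = 0 then 0 else c (n - 1)
  have hd : ∀ N, ∑ n ∈ Finset.range (N + 1), d n = c N := by
    intro N
    induction N with
    | zero => simp [d]
    | succ N ih => rw [Finset.sum_range_succ, ih]; simp [d]
  have hsum : Tendsto (fun N => ∑ n ∈ Finset.range N, d n) atTop (nhds l) := by
    rw [← tendsto_add_atTop_iff_nat 1]
    simpa only [hd] using h
  refine (Real.tendsto_tsum_powerSeries_nhdsWithin_lt hsum).congr' ?_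
  filter_upwards [Ioo_mem_nhdsLT (show (0 : ℝ) < 1 by norm_num)] with x hx
  have hx' : |x| < 1 := by rw [abs_of_pos hx.1]; exact hx.2
  have hs := hc.hasSum hx'
  have hs1 : HasSum (fun n => (if n = 0 then 0 else c (n - 1)) * x ^ n) (x * powerSum c x) := by
    rw [← hasSum_nat_add_iff' 1]
    simp only [Nat.add_eq_zero_iff, one_ne_zero, and_false, if_false, Nat.add_sub_cancel,
      Finset.range_one, Finset.sum_singleton, if_true, zero_mul, sub_zero]
    refine (hs.mul_left x).congr_fun ?_
    intro n
    ring
  have := (hs.sub hs1).tsum_eq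
  rw [sub_mul, one_mul, ← this]
  exact tsum_congr fun n => by simp only [d]; ring

theorem tendsto_cubicG_one : Tendsto cubicG (nhdsWithin 1 (Set.Iio 1)) (nhds (√3 / (2 * π))) :=
  tendsto_one_sub_mul_powerSum convergesBelow_cubicCoeff.natCast_mul tendsto_natCast_mul_cubicCoeff

theorem tendsto_one_sub_mul_cubicF :
    Tendsto (fun x => (1 - x) * cubicF x) (nhdsWithin 1 (Set.Iio 1)) (nhds 0) :=
  tendsto_one_sub_mul_powerSum convergesBelow_cubicCoeff tendsto_cubicCoeff

/-! ### Homogeneous Legendre polynomials -/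

/-- The binary form `∑_{i+j=n} C(n,j)² aⁱ bʲ`. -/
noncomputable def legendreForm (n : ℕ) (a b : ℝ) : ℝ :=
  ∑ ij ∈ Finset.HasAntidiagonal.antidiagonal n, (n.choose ij.2 : ℝ) ^ 2 * (a ^ ij.1 * b ^ ij.2)

theorem legendreP_mul_pow {n : ℕ} {x z a b : ℝ} (ha : z * (x - 1) = 2 * a)
    (hb : z * (x + 1) = 2 * b) : legendreP n x * z ^ n = legendreForm n a b := by
  rw [legendreP, legendreForm, Finset.Nat.antidiagonal_eq_map', Finset.sum_map, mul_right_comm,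
    Finset.mul_sum]
  refine Finset.sum_congr rfl fun j hj => ?_
  have hj : j ≤ n := by simpa [Nat.lt_succ_iff] using hj
  change _ = (n.choose j : ℝ) ^ 2 * (a ^ (n - j) * b ^ j)
  have e : a = 2⁻¹ * (z * (x - 1)) := by rw [ha]; ring
  have e' : b = 2⁻¹ * (z * (x + 1)) := by rw [hb]; ring
  rw [e, e']
  obtain ⟨m, rfl⟩ := Nat.exists_eq_add_of_le' hj
  simp only [Nat.add_sub_cancel, mul_pow, pow_add]
  ring

theorem legendreForm_smul (n : ℕ) (t a b : ℝ) :
    legendreForm n (t * a) (t * b) = legendreForm n a b * t ^ n := by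
  rw [legendreForm, legendreForm, Finset.sum_mul]
  refine Finset.sum_congr rfl fun ij h => ?_
  rw [← Finset.HasAntidiagonal.mem_antidiagonal.1 h]
  ring

theorem legendreForm_zero_right (n : ℕ) (a : ℝ) : legendreForm n a 0 = a ^ n := by
  rw [legendreForm, Finset.sum_eq_single (n, 0)]
  · simp
  · rintro ⟨i, j⟩ h h'
    have hj : j ≠ 0 := by
      rintro rfl
      exact h' (by simpa using h)
    simp [hj]
  · simp

theorem legendreForm_nonneg (n : ℕ) {a b : ℝ} (ha : 0 ≤ a) (hb : 0 ≤ b) : 0 ≤ legendreForm n a b :=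
  Finset.sum_nonneg fun _ _ => by positivity

theorem legendreForm_sq_le (n : ℕ) {α β : ℝ} (ha : 0 ≤ α) (hb : 0 ≤ β) :
    legendreForm n (α ^ 2) (β ^ 2) ≤ ((α + β) ^ 2) ^ n := by
  have h : (α + β) ^ n = ∑ ij ∈ Finset.HasAntidiagonal.antidiagonal n,
      (n.choose ij.2 : ℝ) * (α ^ ij.1 * β ^ ij.2) := by
    rw [(Commute.all α β).add_pow']
    refine Finset.sum_congr rfl fun ij h => ?_
    rw [nsmul_eq_mul, Nat.choose_symm_of_eq_add (Finset.HasAntidiagonal.mem_antidiagonal.1 h).symm]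
  rw [← pow_mul, mul_comm 2 n, pow_mul, h]
  refine le_trans (le_of_eq ?_) (Finset.sum_sq_le_sq_sum_of_nonneg fun ij _ => by positivity)
  refine Finset.sum_congr rfl fun ij _ => ?_
  ring

/-- The parametrisation `a = Y (1 - X)`, `b = X (1 - Y)` of the Legendre forms. -/
noncomputable def legendreXY (n : ℕ) (Y X : ℝ) : ℝ := legendreForm n (Y * (1 - X)) (X * (1 - Y))

theorem legendreXY_nonneg (n : ℕ) {X Y : ℝ} (hX : 0 ≤ X) (hY : 0 ≤ Y) (h : X + Y < 1) :
    0 ≤ legendreXY n Y X :=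
  legendreForm_nonneg n (mul_nonneg hY (by linarith)) (mul_nonneg hX (by linarith))

theorem legendreXY_le (n : ℕ) {X Y : ℝ} (hX : 0 ≤ X) (hY : 0 ≤ Y) (h : X + Y < 1) :
    legendreXY n Y X ≤ (1 - (1 - X - Y) ^ 2) ^ n := by
  have ha : 0 ≤ Y * (1 - X) := mul_nonneg hY (by linarith)
  have hb : 0 ≤ X * (1 - Y) := mul_nonneg hX (by linarith)
  have hXY : 0 ≤ X * Y := mul_nonneg hX hY
  obtain ⟨α, hα, e⟩ : ∃ α, 0 ≤ α ∧ α ^ 2 = Y * (1 - X) := ⟨_, Real.sqrt_nonneg _, Real.sq_sqrt ha⟩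
  obtain ⟨β, hβ, e'⟩ : ∃ α, 0 ≤ α ∧ α ^ 2 = X * (1 - Y) := ⟨_, Real.sqrt_nonneg _, Real.sq_sqrt hb⟩
  rw [legendreXY, ← e, ← e']
  refine (legendreForm_sq_le n hα hβ).trans (pow_le_pow_left₀ (sq_nonneg _) ?_ n)
  have hprod : (1 - (α + β) ^ 2) * (1 - (α - β) ^ 2) = (1 - X - Y) ^ 2 := by
    have : (1 - (α + β) ^ 2) * (1 - (α - β) ^ 2) =
      1 - 2 * (α ^ 2 + β ^ 2) + (α ^ 2 - β ^ 2) ^ 2 := by ring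
    rw [this, e, e']
    ring
  have hpos : 0 < 1 - (α - β) ^ 2 := by nlinarith [mul_nonneg hα hβ]
  have hle : 0 ≤ 1 - (α + β) ^ 2 := by
    by_contra hc
    nlinarith [mul_pos (neg_pos.2 (not_le.1 hc)) hpos, sq_nonneg (1 - X - Y)]
  nlinarith [mul_nonneg hle (sq_nonneg (α - β))]

theorem sum_choose_sq_mul_fst_sq (n : ℕ) (a b : ℝ) :
    ∑ ij ∈ Finset.HasAntidiagonal.antidiagonal (n + 1),
      ((n + 1).choose ij.2 : ℝ) ^ 2 * ((ij.1 : ℝ) ^ 2 * (a ^ (ij.1 - 1) * b ^ ij.2)) =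
    (n + 1) ^ 2 * legendreForm n a b := by
  rw [Finset.Nat.sum_antidiagonal_succ, legendreForm, Finset.mul_sum]
  simp only [CharP.cast_eq_zero, ne_eq, OfNat.ofNat_ne_zero, not_false_eq_true, zero_pow, zero_mul,
    mul_zero, zero_add, Nat.add_sub_cancel]
  refine Finset.sum_congr rfl fun ij h => ?_
  have h := Finset.HasAntidiagonal.mem_antidiagonal.1 h
  have hc := Nat.choose_mul_succ_eq n ij.2
  rw [show n + 1 - ij.2 = ij.1 + 1 by omega] at hc
  have hc' : (n.choose ij.2 : ℝ) * (n + 1) = (n + 1).choose ij.2 * (ij.1 + 1) := by exact_mod_cast hc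
  push_cast
  rw [← mul_assoc, ← mul_pow, ← hc']
  ring

theorem sum_choose_sq_mul_snd_sq (n : ℕ) (a b : ℝ) :
    ∑ ij ∈ Finset.HasAntidiagonal.antidiagonal (n + 1),
      ((n + 1).choose ij.2 : ℝ) ^ 2 * ((ij.2 : ℝ) ^ 2 * (a ^ ij.1 * b ^ (ij.2 - 1))) =
    (n + 1) ^ 2 * legendreForm n a b := by
  rw [Finset.Nat.sum_antidiagonal_succ', legendreForm, Finset.mul_sum]
  simp only [CharP.cast_eq_zero, ne_eq, OfNat.ofNat_ne_zero, not_false_eq_true, zero_pow, zero_mul,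
    mul_zero, zero_add, Nat.add_sub_cancel]
  refine Finset.sum_congr rfl fun ij h => ?_
  have hc := Nat.add_one_mul_choose_eq n ij.2
  have hc' : ((n : ℝ) + 1) * n.choose ij.2 = (n + 1).choose (ij.2 + 1) * (ij.2 + 1) := by
    exact_mod_cast hc
  push_cast
  rw [← mul_assoc, ← mul_pow, ← hc']
  ring

/-- The quasi-derivative `X (1 - X) ∂/∂X` of `legendreXY n Y X`. -/
noncomputable def legendreXYQuasi (n : ℕ) (Y X : ℝ) : ℝ :=
  ∑ ij ∈ Finset.HasAntidiagonal.antidiagonal n, (n.choose ij.2 : ℝ) ^ 2 *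
    ((ij.2 * (1 - X) - ij.1 * X) * ((Y * (1 - X)) ^ ij.1 * (X * (1 - Y)) ^ ij.2))

theorem hasDerivAt_monomialXY (i j : ℕ) (Y X : ℝ) :
    HasDerivAt (fun X : ℝ => (Y * (1 - X)) ^ i * (X * (1 - Y)) ^ j)
      (-(i * Y * ((Y * (1 - X)) ^ (i - 1) * (X * (1 - Y)) ^ j)) +
        j * (1 - Y) * ((Y * (1 - X)) ^ i * (X * (1 - Y)) ^ (j - 1))) X := by
  have h1 := (((hasDerivAt_id' X).const_sub 1).const_mul Y).fun_pow i
  have h2 := ((hasDerivAt_id' X).mul_const (1 - Y)).fun_pow j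
  refine (h1.fun_mul h2).congr_deriv ?_
  ring

theorem natCast_mul_pow_pred (n : ℕ) (a : ℝ) : (n : ℝ) * (a * a ^ (n - 1)) = n * a ^ n := by
  rcases n with _ | n
  · simp
  · rw [Nat.add_sub_cancel, pow_succ' a n]

theorem hasDerivAt_legendreXY (n : ℕ) {X : ℝ} (Y : ℝ) (hX0 : X ≠ 0) (hX1 : X ≠ 1) :
    HasDerivAt (legendreXY n Y) (legendreXYQuasi n Y X / (X * (1 - X))) X := by
  have h := HasDerivAt.fun_sum fun ij (_ : ij ∈ Finset.HasAntidiagonal.antidiagonal n) =>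
    (hasDerivAt_monomialXY ij.1 ij.2 Y X).const_mul ((n.choose ij.2 : ℝ) ^ 2)
  refine h.congr_deriv ?_
  rw [legendreXYQuasi, Finset.sum_div]
  refine Finset.sum_congr rfl fun ij _ => ?_
  have hX1' : 1 - X ≠ 0 := sub_ne_zero.2 hX1.symm
  rw [eq_div_iff (mul_ne_zero hX0 hX1')]
  have e1 := natCast_mul_pow_pred ij.1 (Y * (1 - X))
  have e2 := natCast_mul_pow_pred ij.2 (X * (1 - Y))
  generalize (Y * (1 - X)) ^ (ij.1 - 1) = A at *
  generalize (X * (1 - Y)) ^ (ij.2 - 1) = B at *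
  generalize (Y * (1 - X)) ^ ij.1 = A' at *
  generalize (X * (1 - Y)) ^ ij.2 = B' at *
  linear_combination (-((n.choose ij.2 : ℝ) ^ 2 * X * B')) * e1 +
    ((n.choose ij.2 : ℝ) ^ 2 * (1 - X) * A') * e2

/-- The Legendre operator in `X` acts on `legendreXY n Y X` as it does on `Xⁿ`. -/
theorem hasDerivAt_legendreXYQuasi (n : ℕ) (Y X : ℝ) :
    HasDerivAt (legendreXYQuasi n Y)
      ((n : ℝ) ^ 2 * legendreXY (n - 1) Y X - (n ^ 2 + n) * legendreXY n Y X) X := by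
  have h := HasDerivAt.fun_sum fun ij (_ : ij ∈ Finset.HasAntidiagonal.antidiagonal n) =>
    ((((hasDerivAt_id' X).const_sub 1).const_mul (ij.2 : ℝ)).fun_sub
      ((hasDerivAt_id' X).const_mul (ij.1 : ℝ))).fun_mul
      (hasDerivAt_monomialXY ij.1 ij.2 Y X) |>.const_mul ((n.choose ij.2 : ℝ) ^ 2)
  refine h.congr_deriv ?_
  rcases n with _ | n
  · simp [legendreXY, legendreForm]
  have k1 := sum_choose_sq_mul_fst_sq n (Y * (1 - X)) (X * (1 - Y))
  have k2 := sum_choose_sq_mul_snd_sq n (Y * (1 - X)) (X * (1 - Y))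
  rw [Nat.add_sub_cancel]
  simp only [legendreXY]
  push_cast
  have e : ((n : ℝ) + 1) ^ 2 * legendreForm n (Y * (1 - X)) (X * (1 - Y)) -
      (((n : ℝ) + 1) ^ 2 + (n + 1)) * legendreForm (n + 1) (Y * (1 - X)) (X * (1 - Y)) =
      Y * (((n : ℝ) + 1) ^ 2 * legendreForm n (Y * (1 - X)) (X * (1 - Y))) +
      (1 - Y) * (((n : ℝ) + 1) ^ 2 * legendreForm n (Y * (1 - X)) (X * (1 - Y))) -
      (((n : ℝ) + 1) ^ 2 + (n + 1)) * legendreForm (n + 1) (Y * (1 - X)) (X * (1 - Y)) := by ring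
  rw [e]
  nth_rewrite 1 [← k1]
  rw [← k2]
  simp only [legendreForm, Finset.mul_sum, ← Finset.sum_add_distrib, ← Finset.sum_sub_distrib]
  refine Finset.sum_congr rfl fun ij hij => ?_
  have hn : (n : ℝ) + 1 = ij.1 + ij.2 := by
    exact_mod_cast (Finset.HasAntidiagonal.mem_antidiagonal.1 hij).symm
  have e1 := natCast_mul_pow_pred ij.1 (Y * (1 - X))
  have e2 := natCast_mul_pow_pred ij.2 (X * (1 - Y))
  rw [hn]
  generalize (Y * (1 - X)) ^ (ij.1 - 1) = A at *
  generalize (X * (1 - Y)) ^ (ij.2 - 1) = B at *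
  generalize (Y * (1 - X)) ^ ij.1 = A' at *
  generalize (X * (1 - Y)) ^ ij.2 = B' at *
  generalize ((n + 1).choose ij.2 : ℝ) ^ 2 = c at *
  generalize (ij.1 : ℝ) = i at *
  generalize (ij.2 : ℝ) = j at *
  linear_combination (-(c * (i + j) * B')) * e1 + (-(c * (i + j) * A')) * e2

/-! ### Brafman's product formula -/

theorem sum_cubicCoeff_mul_sub (L : ℕ → ℝ) (N : ℕ) :
    ∑ n ∈ Finset.range N, cubicCoeff n * ((n : ℝ) ^ 2 * L (n - 1) - (n ^ 2 + n) * L n) =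
      2 / 9 * ∑ n ∈ Finset.range N, cubicCoeff n * L n - N ^ 2 * cubicCoeff N * L (N - 1) := by
  induction N with
  | zero => simp
  | succ N ih =>
    rw [Finset.sum_range_succ, Finset.sum_range_succ, ih, Nat.add_sub_cancel]
    have := cubicCoeff_succ N
    push_cast
    linear_combination L N * this

theorem continuous_legendreXY (n : ℕ) (Y : ℝ) : Continuous (legendreXY n Y) := by
  unfold legendreXY legendreForm
  fun_prop

theorem continuous_legendreXYQuasi (n : ℕ) (Y : ℝ) : Continuous (legendreXYQuasi n Y) := by
  unfold legendreXYQuasi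
  fun_prop

theorem legendreXYQuasi_zero_right (n : ℕ) (Y : ℝ) : legendreXYQuasi n Y 0 = 0 := by
  refine Finset.sum_eq_zero fun ij _ => ?_
  rcases ij with ⟨i, _ | j⟩ <;> simp

theorem legendreXY_zero_right (n : ℕ) (Y : ℝ) : legendreXY n Y 0 = Y ^ n := by
  simp [legendreXY, legendreForm_zero_right]

theorem legendreXY_le_of_le (n : ℕ) {x X Y : ℝ} (hx : 0 ≤ x) (hxX : x ≤ X) (hY : 0 ≤ Y)
    (h : X + Y < 1) : legendreXY n Y x ≤ (1 - (1 - X - Y) ^ 2) ^ n := by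
  refine (legendreXY_le n hx hY (by linarith)).trans (pow_le_pow_left₀ ?_ ?_ n) <;> nlinarith

/-- The error term in the Legendre equation satisfied by a partial sum. -/
noncomputable def brafmanError (X Y : ℝ) (N : ℕ) : ℝ :=
  N ^ 2 * (1 - (1 - X - Y) ^ 2) ^ (N - 1) * cubicF X

theorem tendsto_brafmanError {X Y : ℝ} (hX : 0 ≤ X) (hY : 0 ≤ Y) (h : X + Y < 1) :
    Tendsto (brafmanError X Y) atTop (nhds 0) := by
  have h0 : 0 ≤ 1 - (1 - X - Y) ^ 2 := by nlinarith
  have h1 : 1 - (1 - X - Y) ^ 2 < 1 := by nlinarith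
  set q := 1 - (1 - X - Y) ^ 2 with hq
  rw [← tendsto_add_atTop_iff_nat 1]
  have e : ∀ n : ℕ, brafmanError X Y (n + 1) =
      ((n : ℝ) ^ 2 * q ^ n + 2 * (n * q ^ n) + q ^ n) * cubicF X := by
    intro n
    rw [brafmanError, Nat.add_sub_cancel]
    push_cast
    ring
  simp only [e]
  simpa using (((tendsto_pow_const_mul_const_pow_of_lt_one 2 h0 h1).add
    ((tendsto_self_mul_const_pow_of_lt_one h0 h1).const_mul 2)).add
    (tendsto_pow_atTop_nhds_zero_of_lt_one h0 h1)).mul_const (cubicF X)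

theorem abs_wronskian_le {X Y : ℝ} (hY : 0 ≤ Y) (h : X + Y < 1) (N : ℕ) {x : ℝ} (hx0 : 0 < x)
    (hxX : x ≤ X) :
    |(∑ n ∈ Finset.range N, cubicCoeff n * legendreXYQuasi n Y x) * cubicF x -
      (∑ n ∈ Finset.range N, cubicCoeff n * legendreXY n Y x) * cubicG x| ≤
      x * brafmanError X Y N := by
  have hX1 : X < 1 := by linarith
  have hcont : ContinuousOn (fun x =>
      (∑ n ∈ Finset.range N, cubicCoeff n * legendreXYQuasi n Y x) * cubicF x -
      (∑ n ∈ Finset.range N, cubicCoeff n * legendreXY n Y x) * cubicG x) (Set.Icc 0 x) := by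
    have hF : ContinuousOn cubicF (Set.Icc 0 x) := fun y hy =>
      (continuousAt_cubicF (by rw [abs_of_nonneg hy.1]; linarith [hy.2])).continuousWithinAt
    have hG : ContinuousOn cubicG (Set.Icc 0 x) := fun y hy =>
      (continuousAt_cubicG (by rw [abs_of_nonneg hy.1]; linarith [hy.2])).continuousWithinAt
    have hS : Continuous fun x => ∑ n ∈ Finset.range N, cubicCoeff n * legendreXYQuasi n Y x :=
      continuous_finsetSum _ fun n _ => continuous_const.mul (continuous_legendreXYQuasi n Y)
    have hL : Continuous fun x => ∑ n ∈ Finset.range N, cubicCoeff n * legendreXY n Y x :=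
      continuous_finsetSum _ fun n _ => continuous_const.mul (continuous_legendreXY n Y)
    exact (hS.continuousOn.mul hF).sub (hL.continuousOn.mul hG)
  obtain ⟨c, hc, hslope⟩ := exists_hasDerivAt_eq_slope _
    (fun y => -(N ^ 2 * cubicCoeff N * legendreXY (N - 1) Y y * cubicF y)) hx0 hcont (by
      intro y hy
      have hy1 : y < 1 := by linarith [hy.2]
      have hF := hasDerivAt_cubicF hy.1 hy1
      have hG := hasDerivAt_cubicG hy.1 hy1
      have hS := HasDerivAt.fun_sum fun n (_ : n ∈ Finset.range N) =>
        (hasDerivAt_legendreXYQuasi n Y y).const_mul (cubicCoeff n)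
      have hL := HasDerivAt.fun_sum fun n (_ : n ∈ Finset.range N) =>
        (hasDerivAt_legendreXY n Y hy.1.ne' hy1.ne).const_mul (cubicCoeff n)
      refine ((hS.fun_mul hF).fun_sub (hL.fun_mul hG)).congr_deriv ?_
      rw [sum_cubicCoeff_mul_sub (fun n => legendreXY n Y y)]
      simp only [← mul_div_assoc, ← Finset.sum_div]
      ring)
  simp only [legendreXYQuasi_zero_right, cubicG_zero, mul_zero, Finset.sum_const_zero, zero_mul,
    sub_zero] at hslope
  rw [eq_div_iff hx0.ne'] at hslope
  rw [← hslope, abs_mul, abs_of_pos hx0, mul_comm, abs_neg]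
  refine mul_le_mul_of_nonneg_left ?_ hx0.le
  have hc1 : c ≤ X := hc.2.le.trans hxX
  have hF0 := one_le_cubicF hc.1.le (hc1.trans_lt hX1)
  have hF1 := cubicF_mono hc.1.le hc1 hX1
  have hL0 := legendreXY_nonneg (N - 1) hc.1.le hY (by linarith)
  have hL1 := legendreXY_le_of_le (N - 1) hc.1.le hc1 hY h
  have hu0 := (cubicCoeff_pos N).le
  have hu1 := cubicCoeff_le_one N
  rw [abs_of_nonneg (by positivity), brafmanError]
  refine mul_le_mul ?_ hF1 (by linarith) (mul_nonneg (by positivity) (hL0.trans hL1))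
  refine mul_le_mul ?_ hL1 hL0 (by positivity)
  exact mul_le_of_le_one_right (by positivity) hu1

theorem abs_brafman_partial_le {X Y : ℝ} (hX : 0 < X) (hY : 0 ≤ Y) (h : X + Y < 1) (N : ℕ) :
    |(∑ n ∈ Finset.range N, cubicCoeff n * legendreXY n Y X) / cubicF X -
      ∑ n ∈ Finset.range N, cubicCoeff n * Y ^ n| ≤ X / (1 - X) * brafmanError X Y N := by
  have hX1 : X < 1 := by linarith
  have hpos : ∀ y ∈ Set.Icc 0 X, cubicF y ≠ 0 := fun y hy =>
    (zero_lt_one.trans_le (one_le_cubicF hy.1 (hy.2.trans_lt hX1))).ne'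
  have hcont : ContinuousOn (fun x =>
      (∑ n ∈ Finset.range N, cubicCoeff n * legendreXY n Y x) / cubicF x) (Set.Icc 0 X) := by
    have hF : ContinuousOn cubicF (Set.Icc 0 X) := fun y hy =>
      (continuousAt_cubicF (by rw [abs_of_nonneg hy.1]; linarith [hy.2])).continuousWithinAt
    have hL : Continuous fun x => ∑ n ∈ Finset.range N, cubicCoeff n * legendreXY n Y x :=
      continuous_finsetSum _ fun n _ => continuous_const.mul (continuous_legendreXY n Y)
    exact hL.continuousOn.div hF hpos
  obtain ⟨c, hc, hslope⟩ := exists_hasDerivAt_eq_slope _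
    (fun y => ((∑ n ∈ Finset.range N, cubicCoeff n * legendreXYQuasi n Y y) * cubicF y -
      (∑ n ∈ Finset.range N, cubicCoeff n * legendreXY n Y y) * cubicG y) /
      (y * ((1 - y) * cubicF y ^ 2))) hX hcont (by
      intro y hy
      have hy1 : y < 1 := by linarith [hy.2]
      have hF := hasDerivAt_cubicF hy.1 hy1
      have hL := HasDerivAt.fun_sum fun n (_ : n ∈ Finset.range N) =>
        (hasDerivAt_legendreXY n Y hy.1.ne' hy1.ne).const_mul (cubicCoeff n)
      have hy0 := hy.1.ne'
      have hy1' : 1 - y ≠ 0 := by linarith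
      have hFy := hpos y ⟨hy.1.le, hy.2.le⟩
      refine (hL.fun_div hF hFy).congr_deriv ?_
      simp only [← mul_div_assoc, ← Finset.sum_div]
      field_simp)
  simp only [legendreXY_zero_right, cubicF_zero, div_one, sub_zero] at hslope
  rw [eq_div_iff hX.ne'] at hslope
  have hW := abs_wronskian_le hY h N hc.1 hc.2.le
  have hF1 := one_le_cubicF hc.1.le (hc.2.trans hX1)
  have hF2 : 1 ≤ cubicF c ^ 2 := one_le_pow₀ hF1
  have hc1 : 0 < 1 - c := by linarith [hc.2]
  have hX1' : 0 < 1 - X := by linarith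
  have hE : 0 ≤ brafmanError X Y N := nonneg_of_mul_nonneg_right ((abs_nonneg _).trans hW) hc.1
  rw [← hslope, abs_mul, abs_of_pos hX, mul_comm, div_mul_eq_mul_div, mul_div_assoc]
  refine mul_le_mul_of_nonneg_left ?_ hX.le
  have hd : 0 < c * ((1 - c) * cubicF c ^ 2) := mul_pos hc.1 (by positivity)
  rw [abs_div, abs_of_pos hd, div_le_div_iff₀ hd hX1']
  have h3 : 1 - X ≤ (1 - c) * cubicF c ^ 2 := by nlinarith [hc.2]
  calc _ ≤ (c * brafmanError X Y N) * ((1 - c) * cubicF c ^ 2) :=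
        mul_le_mul hW h3 hX1'.le (mul_nonneg hc.1.le hE)
    _ = _ := by ring

/-- Brafman's formula, in Bailey's parametrisation. -/
theorem hasSum_brafman {X Y : ℝ} (hX : 0 < X) (hY : 0 ≤ Y) (h : X + Y < 1) :
    HasSum (fun n => cubicCoeff n * legendreXY n Y X) (cubicF X * cubicF Y) := by
  have hX1 : X < 1 := by linarith
  have hF : cubicF X ≠ 0 := (zero_lt_one.trans_le (one_le_cubicF hX.le hX1)).ne'
  rw [hasSum_iff_tendsto_nat_of_nonneg fun n =>
    mul_nonneg (cubicCoeff_pos n).le (legendreXY_nonneg n hX.le hY h)]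
  have h1 : Tendsto (fun N => (∑ n ∈ Finset.range N, cubicCoeff n * legendreXY n Y X) / cubicF X -
      ∑ n ∈ Finset.range N, cubicCoeff n * Y ^ n) atTop (nhds 0) := by
    refine squeeze_zero_norm (abs_brafman_partial_le hX hY h) ?_
    simpa using (tendsto_brafmanError hX.le hY h).const_mul (X / (1 - X))
  have h2 := (convergesBelow_cubicCoeff.hasSum
    (x := Y) (by rw [abs_of_nonneg hY]; linarith)).tendsto_sum_nat
  have h3 := (h1.add h2).const_mul (cubicF X)
  rw [zero_add] at h3
  refine h3.congr fun N => ?_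
  rw [sub_add_cancel, mul_div_cancel₀ _ hF]

/-! ### Differentiation along the scaling flow -/

/-- Solving `t Y (1 - X) = y (1 - x)`, `t X (1 - Y) = x (1 - y)` for `x`, `y` near `t = 1`;
here `v = 1 / (1 - x - y)`. -/
theorem exists_scaling {X Y : ℝ} (hX : 0 < X) (hY : 0 < Y) (h : X + Y < 1) :
    ∃ x y v : ℝ → ℝ, x 1 = X ∧ y 1 = Y ∧ v 1 = (1 - X - Y)⁻¹ ∧ ∀ᶠ t in nhds 1,
      0 < t ∧ 0 < x t ∧ 0 < y t ∧ x t + y t < 1 ∧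
      t * (Y * (1 - X)) = y t * (1 - x t) ∧ t * (X * (1 - Y)) = x t * (1 - y t) ∧
      HasDerivAt x (x t * (1 - x t) * v t / t) t ∧ HasDerivAt y (y t * (1 - y t) * v t / t) t ∧
      HasDerivAt v ((x t * (1 - x t) + y t * (1 - y t)) * v t ^ 3 / t) t := by
  obtain ⟨a, ha⟩ : ∃ a, a = Y * (1 - X) := ⟨_, rfl⟩
  obtain ⟨b, hb⟩ : ∃ b, b = X * (1 - Y) := ⟨_, rfl⟩
  rw [← ha, ← hb]
  let D : ℝ → ℝ := fun t => 1 - 2 * (a + b) * t + (b - a) ^ 2 * t ^ 2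
  have hDc : Continuous D := by simp only [D]; fun_prop
  have hD1 : D 1 = (1 - X - Y) ^ 2 := by simp only [D, ha, hb]; ring
  have hD1pos : 0 < D 1 := by rw [hD1]; nlinarith
  have hR1 : √(D 1) = 1 - X - Y := by rw [hD1, Real.sqrt_sq (by linarith)]
  have hRc : Continuous fun t => √(D t) := hDc.sqrt
  have hx1 : (1 - √(D 1) + (b - a) * 1) / 2 = X := by rw [hR1, ha, hb]; ring
  have hy1 : (1 - √(D 1) - (b - a) * 1) / 2 = Y := by rw [hR1, ha, hb]; ring
  refine ⟨fun t => (1 - √(D t) + (b - a) * t) / 2, fun t => (1 - √(D t) - (b - a) * t) / 2,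
    fun t => (√(D t))⁻¹, hx1, hy1, by simp only [hR1], ?_⟩
  have ev1 : ∀ᶠ t in nhds 1, 0 < D t := hDc.continuousAt.eventually_const_lt hD1pos
  have ev2 : ∀ᶠ t in nhds 1, 0 < (1 - √(D t) + (b - a) * t) / 2 := by
    have hc : Continuous fun t => (1 - √(D t) + (b - a) * t) / 2 := by fun_prop
    exact hc.continuousAt.eventually_const_lt (by simpa only [hx1] using hX)
  have ev3 : ∀ᶠ t in nhds 1, 0 < (1 - √(D t) - (b - a) * t) / 2 := by
    have hc : Continuous fun t => (1 - √(D t) - (b - a) * t) / 2 := by fun_prop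
    exact hc.continuousAt.eventually_const_lt (by simpa only [hy1] using hY)
  filter_upwards [ev1, ev2, ev3, lt_mem_nhds (zero_lt_one' ℝ)] with t hD hx hy ht
  have hsq : √(D t) ^ 2 = 1 - 2 * (a + b) * t + (b - a) ^ 2 * t ^ 2 := Real.sq_sqrt hD.le
  have hR : 0 < √(D t) := Real.sqrt_pos.2 hD
  have hDd : HasDerivAt D (-(2 * (a + b)) + (b - a) ^ 2 * (2 * t)) t := by
    have := (((hasDerivAt_id' t).const_mul (2 * (a + b))).const_sub 1).fun_add
      ((hasDerivAt_pow 2 t).const_mul ((b - a) ^ 2))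
    refine this.congr_deriv ?_
    push_cast
    ring
  have hRd := hDd.sqrt hD.ne'
  generalize hRt : √(D t) = R at *
  have hR0 := hR.ne'
  have ht0 := ht.ne'
  refine ⟨ht, hx, hy, by linarith, by linear_combination (1 / 4) * hsq,
    by linear_combination (1 / 4) * hsq, ?_, ?_, ?_⟩
  · refine (((hRd.const_sub 1).fun_add ((hasDerivAt_id' t).const_mul (b - a))).div_const
      2).congr_deriv ?_
    field_simp
    linear_combination hsq
  · refine (((hRd.const_sub 1).fun_sub ((hasDerivAt_id' t).const_mul (b - a))).div_const
      2).congr_deriv ?_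
    field_simp
    linear_combination hsq
  · refine (hRd.fun_inv (by rw [hRt]; exact hR0)).congr_deriv ?_
    simp only [hRt]
    field_simp
    linear_combination 2 * hsq

theorem powerSum_natCast_mul_eventuallyEq {c : ℕ → ℝ} {r : ℝ} (hc : ConvergesBelow c r) (hr : 1 < r)
    {f g : ℝ → ℝ} (hf : powerSum c =ᶠ[nhds 1] f)
    (hg : ∀ᶠ t in nhds 1, HasDerivAt f (g t / t) t) :
    powerSum (fun n => n * c n) =ᶠ[nhds 1] g := by
  filter_upwards [hf.eventually_nhds, hg, lt_mem_nhds (zero_lt_one' ℝ), gt_mem_nhds hr]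
    with t h1 h2 h3 h4
  have h5 := (hc.hasDerivAt h3.ne' (by rwa [abs_of_pos h3])).unique (h2.congr_of_eventuallyEq h1)
  exact (div_left_inj' h3.ne').1 h5

/-- The value of `θ (F(X) F(Y))` for the Euler operator `θ` of the scaling flow, where
`A = F(X)`, `B = X (1 - X) F'(X)`, `C = F(Y)`, `D = Y (1 - Y) F'(Y)` and `v = 1 / (1 - X - Y)`. -/
noncomputable def brafmanTheta₁ (v A B C D : ℝ) : ℝ := (B * C + A * D) * v

/-- The value of `θ² (F(X) F(Y))`. -/
noncomputable def brafmanTheta₂ (x y v A B C D : ℝ) : ℝ :=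
  (x * (1 - x) + y * (1 - y)) * v ^ 3 * (B * C + A * D) +
    (2 / 9 * (x * (1 - x) + y * (1 - y)) * (A * C) + 2 * (B * D)) * v ^ 2

/-- The value of `θ³ (F(X) F(Y))`. -/
noncomputable def brafmanTheta₃ (x y v A B C D : ℝ) : ℝ :=
  (((1 - 2 * x) * (x * (1 - x)) + (1 - 2 * y) * (y * (1 - y))) * v ^ 4 +
      3 * (x * (1 - x) + y * (1 - y)) ^ 2 * v ^ 5) * (B * C + A * D) +
    (x * (1 - x) + y * (1 - y)) * v ^ 4 *
      (2 / 9 * (x * (1 - x) + y * (1 - y)) * (A * C) + 2 * (B * D)) +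
    (2 / 9 * ((1 - 2 * x) * (x * (1 - x)) + (1 - 2 * y) * (y * (1 - y))) * v ^ 3 +
      2 * (2 / 9) * (x * (1 - x) + y * (1 - y)) ^ 2 * v ^ 4) * (A * C) +
    2 / 9 * (x * (1 - x) + y * (1 - y)) * v ^ 3 * (B * C + A * D) +
    4 * (x * (1 - x) + y * (1 - y)) * v ^ 4 * (B * D) +
    2 * (2 / 9) * v ^ 3 * (x * (1 - x) * (A * D) + y * (1 - y) * (B * C))

theorem hasSum_brafman_mul_cubic {X Y : ℝ} (hX : 0 < X) (hY : 0 < Y) (h : X + Y < 1)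
    (C₃ C₂ C₁ C₀ : ℝ) :
    HasSum (fun n : ℕ => cubicCoeff n * legendreXY n Y X *
        (C₃ * (n : ℝ) ^ 3 + C₂ * (n : ℝ) ^ 2 + C₁ * n + C₀))
      (C₃ * brafmanTheta₃ X Y (1 - X - Y)⁻¹ (cubicF X) (cubicG X) (cubicF Y) (cubicG Y) +
        C₂ * brafmanTheta₂ X Y (1 - X - Y)⁻¹ (cubicF X) (cubicG X) (cubicF Y) (cubicG Y) +
        C₁ * brafmanTheta₁ (1 - X - Y)⁻¹ (cubicF X) (cubicG X) (cubicF Y) (cubicG Y) +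
        C₀ * (cubicF X * cubicF Y)) := by
  obtain ⟨x, y, v, hx1, hy1, hv1, hev⟩ := exists_scaling hX hY h
  obtain ⟨q, hq⟩ : ∃ q, q = 1 - (1 - X - Y) ^ 2 := ⟨_, rfl⟩
  have hq0 : 0 < q := by rw [hq]; nlinarith
  have hq1 : q < 1 := by rw [hq]; nlinarith
  have hr : 1 < q⁻¹ := (one_lt_inv₀ hq0).2 hq1
  have hc : ConvergesBelow (fun n => cubicCoeff n * legendreXY n Y X) q⁻¹ := by
    intro s hs hsr
    have hqs : q * s < 1 := by rwa [← lt_inv_mul_iff₀ hq0, mul_one]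
    refine Summable.of_nonneg_of_le (fun n => by positivity) (fun n => ?_)
      (summable_geometric_of_lt_one (mul_nonneg hq0.le hs) hqs)
    have h1 := legendreXY_nonneg n hX.le hY.le h
    have h2 := legendreXY_le n hX.le hY.le h
    rw [← hq] at h2
    rw [abs_of_nonneg (mul_nonneg (cubicCoeff_pos n).le h1), mul_pow]
    refine mul_le_mul_of_nonneg_right ?_ (pow_nonneg hs n)
    exact (mul_le_of_le_one_left h1 (cubicCoeff_le_one n)).trans h2
  have e0 : powerSum (fun n => cubicCoeff n * legendreXY n Y X) =ᶠ[nhds 1]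
      fun t => cubicF (x t) * cubicF (y t) := by
    filter_upwards [hev] with t ⟨_, h2, h3, h4, h5, h6, _⟩
    rw [← (hasSum_brafman h2 h3.le h4).tsum_eq, powerSum]
    refine tsum_congr fun n => ?_
    rw [legendreXY, legendreXY, ← h5, ← h6, legendreForm_smul, mul_assoc]
  have hder : ∀ᶠ t in nhds 1,
      HasDerivAt (fun t => cubicF (x t)) (cubicG (x t) * v t / t) t ∧
      HasDerivAt (fun t => cubicG (x t)) (2 / 9 * cubicF (x t) * (x t * (1 - x t) * v t / t)) t ∧
      HasDerivAt (fun t => cubicF (y t)) (cubicG (y t) * v t / t) t ∧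
      HasDerivAt (fun t => cubicG (y t)) (2 / 9 * cubicF (y t) * (y t * (1 - y t) * v t / t)) t := by
    filter_upwards [hev] with t ⟨h1, h2, h3, h4, _, _, h5, h6, _⟩
    have hx : x t < 1 := by linarith
    have hy : y t < 1 := by linarith
    have hx' : 1 - x t ≠ 0 := by linarith
    have hy' : 1 - y t ≠ 0 := by linarith
    refine ⟨((hasDerivAt_cubicF h2 hx).comp t h5).congr_deriv ?_, (hasDerivAt_cubicG h2 hx).comp t h5,
      ((hasDerivAt_cubicF h3 hy).comp t h6).congr_deriv ?_, (hasDerivAt_cubicG h3 hy).comp t h6⟩ <;>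
    field_simp
  have e1 := powerSum_natCast_mul_eventuallyEq hc hr e0
    (g := fun t => brafmanTheta₁ (v t) (cubicF (x t)) (cubicG (x t)) (cubicF (y t)) (cubicG (y t))) (by
      filter_upwards [hder] with t ⟨h1, h2, h3, h4⟩
      refine (h1.fun_mul h3).congr_deriv ?_
      simp only [brafmanTheta₁]
      ring)
  have e2 := powerSum_natCast_mul_eventuallyEq hc.natCast_mul hr e1
    (g := fun t => brafmanTheta₂ (x t) (y t) (v t)
      (cubicF (x t)) (cubicG (x t)) (cubicF (y t)) (cubicG (y t))) (by
      filter_upwards [hder, hev] with t ⟨h1, h2, h3, h4⟩ ⟨_, _, _, _, _, _, h5, h6, h7⟩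
      refine (((h2.fun_mul h3).fun_add (h1.fun_mul h4)).fun_mul h7).congr_deriv ?_
      simp only [brafmanTheta₂]
      ring)
  have e3 := powerSum_natCast_mul_eventuallyEq hc.natCast_mul.natCast_mul hr e2
    (g := fun t => brafmanTheta₃ (x t) (y t) (v t)
      (cubicF (x t)) (cubicG (x t)) (cubicF (y t)) (cubicG (y t))) (by
      filter_upwards [hder, hev] with t ⟨h1, h2, h3, h4⟩ ⟨_, _, _, _, _, _, h5, h6, h7⟩
      have hs := (h5.fun_mul (h5.const_sub 1)).fun_add (h6.fun_mul (h6.const_sub 1))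
      refine (((hs.fun_mul (h7.fun_pow 3)).fun_mul
        ((h2.fun_mul h3).fun_add (h1.fun_mul h4))).fun_add
        ((((hs.const_mul (2 / 9)).fun_mul (h1.fun_mul h3)).fun_add
          ((h2.fun_mul h4).const_mul 2)).fun_mul (h7.fun_pow 2))).congr_deriv ?_
      simp only [brafmanTheta₃]
      push_cast
      ring)
  have h1r : |(1 : ℝ)| < q⁻¹ := by rwa [abs_one]
  have s0 := hc.hasSum h1r
  have s1 := hc.natCast_mul.hasSum h1r
  have s2 := hc.natCast_mul.natCast_mul.hasSum h1r
  have s3 := hc.natCast_mul.natCast_mul.natCast_mul.hasSum h1r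
  rw [e0.eq_of_nhds] at s0
  rw [e1.eq_of_nhds] at s1
  rw [e2.eq_of_nhds] at s2
  rw [e3.eq_of_nhds] at s3
  simp only [hx1, hy1, hv1] at s0 s1 s2 s3
  refine ((((s3.mul_left C₃).add (s2.mul_left C₂)).add (s1.mul_left C₁)).add
    (s0.mul_left C₀)).congr_fun fun n => ?_
  simp only [one_pow, mul_one]
  ring

/-! ### The cubic transformation and its invariant -/

/-- The first modulus `((1 - k) / (1 + 2 k))³`; the second one is `k³`. -/
noncomputable def cubicModulus (k : ℝ) : ℝ := ((1 - k) / (1 + 2 * k)) ^ 3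

theorem cubicModulus_pos {k : ℝ} (h0 : 0 < k) (h1 : k < 1) : 0 < cubicModulus k := by
  have : 0 < 1 - k := by linarith
  unfold cubicModulus
  positivity

theorem one_sub_cubicModulus_sub {k : ℝ} (h0 : 0 < k) :
    1 - cubicModulus k - k ^ 3 =
      k * (1 - k) * (3 + 4 * k + 2 * k ^ 2) * (3 + 2 * k + 4 * k ^ 2) / (1 + 2 * k) ^ 3 := by
  unfold cubicModulus
  field_simp
  ring

theorem cubicModulus_add_lt {k : ℝ} (h0 : 0 < k) (h1 : k < 1) : cubicModulus k + k ^ 3 < 1 := by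
  have h := one_sub_cubicModulus_sub h0
  have h2 : 0 < 1 - k := by linarith
  have : 0 < 1 - cubicModulus k - k ^ 3 := by rw [h]; positivity
  linarith

theorem hasDerivAt_cubicModulus {k : ℝ} (h0 : 0 < k) :
    HasDerivAt cubicModulus (-9 * (1 - k) ^ 2 / (1 + 2 * k) ^ 4) k := by
  have h : 1 + 2 * k ≠ 0 := by positivity
  refine ((((hasDerivAt_id' k).const_sub 1).fun_div
    (((hasDerivAt_id' k).const_mul 2).const_add 1) h).fun_pow 3).congr_deriv ?_
  push_cast
  field_simp
  ring

/-- A bilinear Wronskian-type combination of the two hypergeometric functions related by the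
cubic transformation; it is constant in `k`, an analogue of Legendre's relation. -/
noncomputable def legendreInvariant (k : ℝ) : ℝ :=
  (1 + 2 * k) * (cubicG (cubicModulus k) * cubicF (k ^ 3)) +
    3 / (1 + 2 * k) * (cubicF (cubicModulus k) * cubicG (k ^ 3)) +
    2 * k * (1 - k ^ 3) / (1 + 2 * k) ^ 2 * (cubicF (cubicModulus k) * cubicF (k ^ 3))

theorem hasDerivAt_legendreInvariant {k : ℝ} (h0 : 0 < k) (h1 : k < 1) :
    HasDerivAt legendreInvariant 0 k := by
  have hX0 := cubicModulus_pos h0 h1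
  have hXY := cubicModulus_add_lt h0 h1
  have hY0 : 0 < k ^ 3 := by positivity
  have hX1 : cubicModulus k < 1 := by linarith
  have hY1 : k ^ 3 < 1 := by linarith
  have hdX := hasDerivAt_cubicModulus h0
  have hdY := hasDerivAt_pow 3 k
  have h2 : 1 + 2 * k ≠ 0 := by positivity
  have hk1 : 1 - k ≠ 0 := by linarith
  have hX : cubicModulus k * (1 - cubicModulus k) =
      9 * k * (1 + k + k ^ 2) * (1 - k) ^ 3 / (1 + 2 * k) ^ 6 := by
    unfold cubicModulus
    field_simp
    ring
  have hq : 1 + k + k ^ 2 ≠ 0 := by positivity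
  have hY : k ^ 3 * (1 - k ^ 3) = k ^ 3 * (1 - k) * (1 + k + k ^ 2) := by ring
  have hFX : HasDerivAt (fun k => cubicF (cubicModulus k))
      (cubicG (cubicModulus k) * (-(1 + 2 * k) ^ 2 / (k * (1 - k) * (1 + k + k ^ 2)))) k := by
    refine ((hasDerivAt_cubicF hX0 hX1).comp k hdX).congr_deriv ?_
    rw [hX]
    field_simp
  have hGX : HasDerivAt (fun k => cubicG (cubicModulus k)) _ k :=
    (hasDerivAt_cubicG hX0 hX1).comp k hdX
  have hFY : HasDerivAt (fun k => cubicF (k ^ 3))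
      (cubicG (k ^ 3) * (3 / (k * (1 - k) * (1 + k + k ^ 2)))) k := by
    refine (HasDerivAt.comp (h := fun k : ℝ => k ^ 3) k (hasDerivAt_cubicF hY0 hY1)
      hdY).congr_deriv ?_
    rw [hY]
    push_cast
    field_simp
  have hGY : HasDerivAt (fun k => cubicG (k ^ 3)) _ k :=
    HasDerivAt.comp (h := fun k : ℝ => k ^ 3) k (hasDerivAt_cubicG hY0 hY1) hdY
  have hl := ((hasDerivAt_id' k).const_mul 2).const_add 1
  have ht := (((hasDerivAt_id' k).const_mul 2).fun_mul (hdY.const_sub 1)).fun_div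
    (hl.fun_pow 2) (pow_ne_zero 2 h2)
  refine (((hl.fun_mul (hGX.fun_mul hFY)).fun_add
    (((hasDerivAt_const k (3 : ℝ)).fun_div hl h2).fun_mul (hFX.fun_mul hGY))).fun_add
    (ht.fun_mul (hFX.fun_mul hFY))).congr_deriv ?_
  generalize cubicF (cubicModulus k) = A
  generalize cubicG (cubicModulus k) = B
  generalize cubicF (k ^ 3) = C
  generalize cubicG (k ^ 3) = D
  push_cast
  field_simp
  ring

theorem abs_cubicG_le {x : ℝ} (hx0 : 0 < x) (hx1 : x < 1) :
    |cubicG x| ≤ 2 / 9 * cubicF x * x := by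
  obtain ⟨c, hc, h⟩ := exists_hasDerivAt_eq_slope cubicG (fun t => 2 / 9 * cubicF t) hx0
    (fun t ht => (continuousAt_cubicG (abs_lt.2 ⟨by linarith [ht.1], by linarith [ht.2]⟩)
      ).continuousWithinAt)
    (fun t ht => hasDerivAt_cubicG ht.1 (ht.2.trans hx1))
  rw [cubicG_zero, sub_zero, sub_zero, eq_div_iff hx0.ne'] at h
  have h1 := one_le_cubicF hc.1.le (hc.2.trans hx1)
  have h2 := cubicF_mono hc.1.le hc.2.le hx1
  rw [← h, abs_of_nonneg (by positivity)]
  gcongr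

theorem tendsto_legendreInvariant :
    Tendsto legendreInvariant (nhdsWithin 0 (Set.Ioi 0)) (nhds (√3 / (2 * π))) := by
  have hI : ∀ᶠ k : ℝ in nhdsWithin 0 (Set.Ioi 0), k ∈ Set.Ioo (0 : ℝ) 1 :=
    Ioo_mem_nhdsGT zero_lt_one
  have hid : Tendsto (fun k : ℝ => k) (nhdsWithin 0 (Set.Ioi 0)) (nhds 0) :=
    tendsto_id.mono_left nhdsWithin_le_nhds
  have hX : Tendsto cubicModulus (nhdsWithin 0 (Set.Ioi 0)) (nhdsWithin 1 (Set.Iio 1)) := by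
    refine tendsto_nhdsWithin_iff.2 ⟨?_, ?_⟩
    · have hc : ContinuousAt cubicModulus 0 := by
        unfold cubicModulus
        exact (ContinuousAt.div (by fun_prop) (by fun_prop) (by norm_num)).pow 3
      have h := hc.tendsto.mono_left (nhdsWithin_le_nhds (s := Set.Ioi 0))
      simpa [cubicModulus] using h
    · filter_upwards [hI] with k hk
      have h := cubicModulus_add_lt hk.1 hk.2
      have h3 : 0 < k ^ 3 := pow_pos hk.1 3
      exact Set.mem_Iio.2 (by linarith)
  have hG := tendsto_cubicG_one.comp hX
  have hF := tendsto_one_sub_mul_cubicF.comp hX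
  have hY : Tendsto (fun k : ℝ => k ^ 3) (nhdsWithin 0 (Set.Ioi 0)) (nhds 0) := by
    simpa using hid.pow 3
  have hFY : Tendsto (fun k : ℝ => cubicF (k ^ 3)) (nhdsWithin 0 (Set.Ioi 0)) (nhds 1) := by
    have h := (continuousAt_cubicF (x := 0) (by simp)).tendsto.comp hY
    rwa [cubicF_zero] at h
  have hGY : Tendsto (fun k : ℝ => cubicG (k ^ 3) / k) (nhdsWithin 0 (Set.Ioi 0)) (nhds 0) := by
    have hb : Tendsto (fun k : ℝ => 2 / 9 * k ^ 2 * cubicF (k ^ 3)) (nhdsWithin 0 (Set.Ioi 0))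
        (nhds 0) := by
      simpa using ((hid.pow 2).const_mul (2 / 9)).mul hFY
    refine squeeze_zero_norm' ?_ hb
    filter_upwards [hI] with k hk
    have h := abs_cubicG_le (pow_pos hk.1 3) (pow_lt_one₀ hk.1.le hk.2 three_ne_zero)
    rw [Real.norm_eq_abs, abs_div, abs_of_pos hk.1, div_le_iff₀ hk.1]
    exact h.trans_eq (by ring)
  have hkF : Tendsto (fun k : ℝ => k * cubicF (cubicModulus k)) (nhdsWithin 0 (Set.Ioi 0))
      (nhds 0) := by
    have hq : Tendsto (fun k : ℝ => (1 + 2 * k) ^ 3 / (9 * (1 + k + k ^ 2)))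
        (nhdsWithin 0 (Set.Ioi 0)) (nhds ((1 + 2 * 0) ^ 3 / (9 * (1 + 0 + 0 ^ 2)))) :=
      (((hid.const_mul 2).const_add 1).pow 3).div
        (((hid.const_add 1).add (hid.pow 2)).const_mul 9) (by norm_num)
    have h := hq.mul hF
    rw [mul_zero] at h
    refine h.congr' ?_
    filter_upwards [hI] with k hk
    have h0 := hk.1
    have hm : 1 - cubicModulus k = 9 * k * (1 + k + k ^ 2) / (1 + 2 * k) ^ 3 := by
      unfold cubicModulus
      field_simp
      ring
    simp only [Function.comp_apply, hm]
    field_simp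
  have hl : Tendsto (fun k : ℝ => 1 + 2 * k) (nhdsWithin 0 (Set.Ioi 0)) (nhds (1 + 2 * 0)) :=
    (hid.const_mul 2).const_add 1
  have hl0 : (1 + 2 * 0 : ℝ) ≠ 0 := by norm_num
  have h := ((hl.mul (hG.mul hFY)).add (((tendsto_const_nhds (x := (3 : ℝ))).div hl hl0).mul
    (hkF.mul hGY))).add ((((hY.const_sub 1).const_mul 2).div (hl.pow 2) (pow_ne_zero 2 hl0)).mul
    (hkF.mul hFY))
  have hlim : (1 + 2 * 0) * (√3 / (2 * π) * 1) + 3 / (1 + 2 * 0) * (0 * 0) +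
      2 * (1 - 0) / (1 + 2 * 0) ^ 2 * (0 * 1) = √3 / (2 * π) := by ring
  rw [hlim] at h
  refine h.congr' ?_
  filter_upwards [hI] with k hk
  have h0 := hk.1
  simp only [Function.comp_apply, Pi.div_apply, legendreInvariant]
  field_simp

theorem legendreInvariant_eq {k : ℝ} (h0 : 0 < k) (h1 : k < 1) :
    legendreInvariant k = √3 / (2 * π) := by
  have hconst : ∀ x ∈ Set.Ioo (0 : ℝ) 1, legendreInvariant x = legendreInvariant k := fun x hx =>
    isOpen_Ioo.is_const_of_deriv_eq_zero isPreconnected_Ioo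
      (fun y hy => (hasDerivAt_legendreInvariant hy.1 hy.2).differentiableAt.differentiableWithinAt)
      (fun y hy => (hasDerivAt_legendreInvariant hy.1 hy.2).deriv) hx ⟨h0, h1⟩
  refine tendsto_nhds_unique (tendsto_const_nhds.congr' ?_) tendsto_legendreInvariant
  filter_upwards [Ioo_mem_nhdsGT (zero_lt_one' ℝ)] with x hx
  exact (hconst x hx).symm

/-! ### The series -/

theorem brafmanTheta_combination {k : ℝ} (h0 : 0 < k) (h1 : k < 1) (A B C D : ℝ) :
    (9 * (k - 1) ^ 2 * k ^ 2 / (1 + k + k ^ 2)) * (3 + 4 * k + 2 * k ^ 2) ^ 2 *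
      (3 + 2 * k + 4 * k ^ 2) ^ 2 *
      brafmanTheta₃ (cubicModulus k) (k ^ 3) (1 - cubicModulus k - k ^ 3)⁻¹ A B C D +
    27 * (k - 1) * k * (9 - 18 * k + 10 * k ^ 2 + 12 * k ^ 3 + 60 * k ^ 4 + 160 * k ^ 5 +
      240 * k ^ 6 + 192 * k ^ 7 + 64 * k ^ 8) *
      brafmanTheta₂ (cubicModulus k) (k ^ 3) (1 - cubicModulus k - k ^ 3)⁻¹ A B C D +
    (9 - 144 * k + 540 * k ^ 2 - 584 * k ^ 3 + 314 * k ^ 4 - 228 * k ^ 5 - 1256 * k ^ 6 -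
      1072 * k ^ 7 + 768 * k ^ 8 + 2560 * k ^ 9 + 1280 * k ^ 10) *
      brafmanTheta₁ (1 - cubicModulus k - k ^ 3)⁻¹ A B C D +
    2 * (1 - 2 * k - 2 * k ^ 2) ^ 2 *
      (1 - 10 * k + 12 * k ^ 2 - 24 * k ^ 3 + 16 * k ^ 4 + 32 * k ^ 6) *
      (A * C) =
    2 * ((1 + 2 * k) ^ 4 * (1 - 2 * k + 4 * k ^ 2)) *
      ((1 + 2 * k) * (B * C) + 3 / (1 + 2 * k) * (A * D) +
        2 * k * (1 - k ^ 3) / (1 + 2 * k) ^ 2 * (A * C)) := by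
  have hk : 1 - k ≠ 0 := by linarith
  have hl : 1 + 2 * k ≠ 0 := by positivity
  have hp : 3 + 4 * k + 2 * k ^ 2 ≠ 0 := by positivity
  have hq : 3 + 2 * k + 4 * k ^ 2 ≠ 0 := by positivity
  have hr : 1 + k + k ^ 2 ≠ 0 := by positivity
  rw [one_sub_cubicModulus_sub h0]
  unfold brafmanTheta₁ brafmanTheta₂ brafmanTheta₃ cubicModulus
  field_simp
  ring

theorem stmt14 (k : ℝ) (hk0 : 0 < k) (hk1 : k < 1) (hk : k ≠ (Real.sqrt 3 - 1) / 2) :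
    Tendsto (fun N => ∑ n ∈ Finset.range N,
      (poch (1 / 3) n * poch (2 / 3) n / (n.factorial : ℝ) ^ 2) *
        legendreP n ((1 - 4 * k + 6 * k ^ 2 - 4 * k ^ 3 + 10 * k ^ 4) /
          ((1 - 2 * k - 2 * k ^ 2) * (1 - 2 * k + 4 * k ^ 2))) *
        ((1 + k + k ^ 2) * (1 - 2 * k - 2 * k ^ 2) * (1 - 2 * k + 4 * k ^ 2) / (1 + 2 * k) ^ 3) ^ n *
        ((9 * (k - 1) ^ 2 * k ^ 2 / (1 + k + k ^ 2)) * (3 + 4 * k + 2 * k ^ 2) ^ 2 *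
            (3 + 2 * k + 4 * k ^ 2) ^ 2 * (n : ℝ) ^ 3 +
         27 * (k - 1) * k * (9 - 18 * k + 10 * k ^ 2 + 12 * k ^ 3 + 60 * k ^ 4 + 160 * k ^ 5 +
            240 * k ^ 6 + 192 * k ^ 7 + 64 * k ^ 8) * (n : ℝ) ^ 2 +
         (9 - 144 * k + 540 * k ^ 2 - 584 * k ^ 3 + 314 * k ^ 4 - 228 * k ^ 5 - 1256 * k ^ 6 -
            1072 * k ^ 7 + 768 * k ^ 8 + 2560 * k ^ 9 + 1280 * k ^ 10) * (n : ℝ) +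
         2 * (1 - 2 * k - 2 * k ^ 2) ^ 2 *
            (1 - 10 * k + 12 * k ^ 2 - 24 * k ^ 3 + 16 * k ^ 4 + 32 * k ^ 6)))
      atTop (nhds (Real.sqrt 3 * (1 + 2 * k) ^ 4 * (1 - 2 * k + 4 * k ^ 2) / π)) := by
  have hX := cubicModulus_pos hk0 hk1
  have hY : 0 < k ^ 3 := pow_pos hk0 3
  have hXY := cubicModulus_add_lt hk0 hk1
  have hl : 1 + 2 * k ≠ 0 := by positivity
  have hq : 1 - 2 * k + 4 * k ^ 2 ≠ 0 := by nlinarith [sq_nonneg (1 - 4 * k)]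
  have hp : 1 - 2 * k - 2 * k ^ 2 ≠ 0 := by
    intro h
    have h3 : √3 = 2 * k + 1 := by
      rw [Real.sqrt_eq_iff_mul_self_eq (by norm_num) (by linarith)]
      linarith
    exact hk (by rw [h3]; ring)
  have hz : ∀ M : ℝ, (1 + k + k ^ 2) * (1 - 2 * k - 2 * k ^ 2) * (1 - 2 * k + 4 * k ^ 2) /
      (1 + 2 * k) ^ 3 * (M / ((1 - 2 * k - 2 * k ^ 2) * (1 - 2 * k + 4 * k ^ 2))) =
      (1 + k + k ^ 2) * M / (1 + 2 * k) ^ 3 := by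
    intro M
    generalize 1 - 2 * k - 2 * k ^ 2 = p at hp ⊢
    generalize 1 - 2 * k + 4 * k ^ 2 = q at hq ⊢
    field_simp
  have ha : (1 + k + k ^ 2) * (1 - 2 * k - 2 * k ^ 2) * (1 - 2 * k + 4 * k ^ 2) / (1 + 2 * k) ^ 3 *
      ((1 - 4 * k + 6 * k ^ 2 - 4 * k ^ 3 + 10 * k ^ 4) /
          ((1 - 2 * k - 2 * k ^ 2) * (1 - 2 * k + 4 * k ^ 2)) - 1) =
      2 * (k ^ 3 * (1 - cubicModulus k)) := by
    rw [div_sub_one (mul_ne_zero hp hq), hz]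
    unfold cubicModulus
    field_simp
    ring
  have hb : (1 + k + k ^ 2) * (1 - 2 * k - 2 * k ^ 2) * (1 - 2 * k + 4 * k ^ 2) / (1 + 2 * k) ^ 3 *
      ((1 - 4 * k + 6 * k ^ 2 - 4 * k ^ 3 + 10 * k ^ 4) /
          ((1 - 2 * k - 2 * k ^ 2) * (1 - 2 * k + 4 * k ^ 2)) + 1) =
      2 * (cubicModulus k * (1 - k ^ 3)) := by
    rw [div_add_one (mul_ne_zero hp hq), hz]
    unfold cubicModulus
    field_simp
    ring
  have h := hasSum_brafman_mul_cubic hX hY hXY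
    ((9 * (k - 1) ^ 2 * k ^ 2 / (1 + k + k ^ 2)) * (3 + 4 * k + 2 * k ^ 2) ^ 2 *
      (3 + 2 * k + 4 * k ^ 2) ^ 2)
    (27 * (k - 1) * k * (9 - 18 * k + 10 * k ^ 2 + 12 * k ^ 3 + 60 * k ^ 4 + 160 * k ^ 5 +
      240 * k ^ 6 + 192 * k ^ 7 + 64 * k ^ 8))
    (9 - 144 * k + 540 * k ^ 2 - 584 * k ^ 3 + 314 * k ^ 4 - 228 * k ^ 5 - 1256 * k ^ 6 -
      1072 * k ^ 7 + 768 * k ^ 8 + 2560 * k ^ 9 + 1280 * k ^ 10)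
    (2 * (1 - 2 * k - 2 * k ^ 2) ^ 2 *
      (1 - 10 * k + 12 * k ^ 2 - 24 * k ^ 3 + 16 * k ^ 4 + 32 * k ^ 6))
  have hI := legendreInvariant_eq hk0 hk1
  rw [legendreInvariant] at hI
  rw [brafmanTheta_combination hk0 hk1, hI] at h
  have hv : 2 * ((1 + 2 * k) ^ 4 * (1 - 2 * k + 4 * k ^ 2)) * (√3 / (2 * π)) =
      √3 * (1 + 2 * k) ^ 4 * (1 - 2 * k + 4 * k ^ 2) / π := by
    field_simp
  rw [hv] at h
  refine h.tendsto_sum_nat.congr fun N => Finset.sum_congr rfl fun n _ => ?_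
  rw [mul_assoc (_ / _) (legendreP _ _), legendreP_mul_pow ha hb, cubicCoeff, legendreXY]
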